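/- Consistent tangent operator for the Drucker–Prager smooth return: the set U = {ε ∈ Sym(3) : Ψ(σ^tr(ε)) > 0 and η p^tr − (Kη²/(G√2)) ρ^tr < c} is open, and on U the operator T_k is Fréchet differentiable with derivative given, for every direction h ∈ Sym(3), by DT_k(ε)[h] = ℂh − (1/(G + Kη²))·[ (2G²√2·Ψ(σ^tr(ε))/ρ^tr)·(dev(h) − (n^tr : h)·n^tr) + ((G√2 n^tr + Kη I) : h)·(G√2 n^tr + Kη I) ]. -/

import Mathlib

open Matrix

/-- Frobenius inner product on 3×3 real matrices. -/
noncomputable def frob (σ τ : Matrix (Fin 3) (Fin 3) ℝ) : ℝ := ∑ i, ∑ j, σ i j * τ i j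

/-- Frobenius norm. -/
noncomputable def fnorm (τ : Matrix (Fin 3) (Fin 3) ℝ) : ℝ := Real.sqrt (frob τ τ)

/-- Deviatoric part. -/
noncomputable def devM (τ : Matrix (Fin 3) (Fin 3) ℝ) : Matrix (Fin 3) (Fin 3) ℝ :=
  τ - (Matrix.trace τ / 3) • (1 : Matrix (Fin 3) (Fin 3) ℝ)

/-- The isotropic elasticity tensor `ℂε = K tr(ε) I + 2G dev(ε)`. -/
noncomputable def Celast (K G : ℝ) (ε : Matrix (Fin 3) (Fin 3) ℝ) : Matrix (Fin 3) (Fin 3) ℝ :=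
  (K * Matrix.trace ε) • (1 : Matrix (Fin 3) (Fin 3) ℝ) + (2 * G) • devM ε

attribute [local instance] Matrix.frobeniusNormedAddCommGroup Matrix.frobeniusNormedSpace

/-- The Drucker–Prager yield function `Ψ(τ) = √(1/2)|dev τ| + (η/3) tr τ − c`. -/
noncomputable def PsiDP (η c : ℝ) (τ : Matrix (Fin 3) (Fin 3) ℝ) : ℝ :=
  Real.sqrt (1 / 2) * fnorm (devM τ) + η / 3 * Matrix.trace τ - c

/-- The Drucker–Prager stress-strain operator `T_k`, defined piecewise by the elastic
branch, the return to the smooth portion of the yield surface, and the return to the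
apex. -/
noncomputable def TDP (K G η c : ℝ) (εp ε : Matrix (Fin 3) (Fin 3) ℝ) :
    Matrix (Fin 3) (Fin 3) ℝ :=
  let σtr := Celast K G (ε - εp)
  let str := devM σtr
  let ρtr := fnorm str
  let ptr := Matrix.trace σtr / 3
  let Δlam := PsiDP η c σtr / (G + K * η ^ 2)
  if PsiDP η c σtr ≤ 0 then σtr
  else if η * ptr - K * η ^ 2 / (G * Real.sqrt 2) * ρtr < c then
    σtr - (Δlam * (G * Real.sqrt 2)) • (ρtr⁻¹ • str) -
      (Δlam * (K * η)) • (1 : Matrix (Fin 3) (Fin 3) ℝ)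
  else (c / η) • (1 : Matrix (Fin 3) (Fin 3) ℝ)

/-- Trial stress `σ^tr(ε) = ℂ(ε − εₖ₋₁ᵖ)`. -/
noncomputable def sigTrDP (K G : ℝ) (εp ε : Matrix (Fin 3) (Fin 3) ℝ) :
    Matrix (Fin 3) (Fin 3) ℝ :=
  Celast K G (ε - εp)

/-- Normalized trial flow direction `n^tr(ε)`. -/
noncomputable def ntrDP (K G : ℝ) (εp ε : Matrix (Fin 3) (Fin 3) ℝ) :
    Matrix (Fin 3) (Fin 3) ℝ :=
  (fnorm (devM (sigTrDP K G εp ε)))⁻¹ • devM (sigTrDP K G εp ε)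

theorem devM_add (σ τ : Matrix (Fin 3) (Fin 3) ℝ) : devM (σ + τ) = devM σ + devM τ := by
  simp only [devM, trace_add, add_div]; module

theorem devM_smul (a : ℝ) (τ : Matrix (Fin 3) (Fin 3) ℝ) : devM (a • τ) = a • devM τ := by
  simp only [devM, trace_smul, smul_eq_mul]; module

theorem trace_devM (τ : Matrix (Fin 3) (Fin 3) ℝ) : trace (devM τ) = 0 := by
  simp [devM, trace_sub, trace_smul]

theorem frob_add_right (σ τ υ : Matrix (Fin 3) (Fin 3) ℝ) :
    frob σ (τ + υ) = frob σ τ + frob σ υ := by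
  simp [frob, mul_add, Finset.sum_add_distrib]

theorem frob_smul_right (a : ℝ) (σ τ : Matrix (Fin 3) (Fin 3) ℝ) :
    frob σ (a • τ) = a * frob σ τ := by
  simp only [frob, Matrix.smul_apply, smul_eq_mul, Finset.mul_sum, mul_left_comm]

theorem frob_comm (σ τ : Matrix (Fin 3) (Fin 3) ℝ) : frob σ τ = frob τ σ := by
  simp only [frob, mul_comm]

theorem frob_add_left (σ τ υ : Matrix (Fin 3) (Fin 3) ℝ) :
    frob (σ + τ) υ = frob σ υ + frob τ υ := by
  simp only [frob_comm _ υ, frob_add_right]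

theorem frob_smul_left (a : ℝ) (σ τ : Matrix (Fin 3) (Fin 3) ℝ) :
    frob (a • σ) τ = a * frob σ τ := by
  simp only [frob_comm _ τ, frob_smul_right]

theorem frob_one_right (τ : Matrix (Fin 3) (Fin 3) ℝ) : frob τ 1 = trace τ := by
  simp [frob, one_apply, trace]

theorem frob_one_left (τ : Matrix (Fin 3) (Fin 3) ℝ) : frob 1 τ = trace τ := by
  rw [frob_comm, frob_one_right]

/-- Against a trace-free matrix, only the deviatoric part contributes. -/
theorem frob_devM_right {σ : Matrix (Fin 3) (Fin 3) ℝ} (hσ : trace σ = 0)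
    (τ : Matrix (Fin 3) (Fin 3) ℝ) : frob σ (devM τ) = frob σ τ := by
  have h : devM τ = τ + (-(trace τ / 3)) • (1 : Matrix (Fin 3) (Fin 3) ℝ) := by
    simp only [devM]; module
  rw [h, frob_add_right, frob_smul_right, frob_one_right, hσ, mul_zero, add_zero]

theorem trace_Celast (K G : ℝ) (ε : Matrix (Fin 3) (Fin 3) ℝ) :
    trace (Celast K G ε) = 3 * K * trace ε := by
  simp only [Celast, trace_add, trace_smul, trace_devM, trace_one, Fintype.card_fin, smul_eq_mul]
  push_cast; ring

theorem devM_Celast (K G : ℝ) (ε : Matrix (Fin 3) (Fin 3) ℝ) :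
    devM (Celast K G ε) = (2 * G) • devM ε := by
  have h : devM (1 : Matrix (Fin 3) (Fin 3) ℝ) = 0 := by simp [devM]
  have h' : devM (devM ε) = devM ε := by
    conv_lhs => rw [devM, trace_devM]
    simp
  rw [Celast, devM_add, devM_smul, devM_smul, h, h', smul_zero, zero_add]

/-- `devM` as a continuous linear map. -/
noncomputable def devCLM : Matrix (Fin 3) (Fin 3) ℝ →L[ℝ] Matrix (Fin 3) (Fin 3) ℝ :=
  LinearMap.toContinuousLinearMap
    { toFun := devM, map_add' := devM_add, map_smul' := devM_smul }

/-- The trace as a continuous linear functional. -/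
noncomputable def traceCLM : Matrix (Fin 3) (Fin 3) ℝ →L[ℝ] ℝ :=
  LinearMap.toContinuousLinearMap (traceLinearMap (Fin 3) ℝ ℝ)

/-- The Frobenius inner product against a fixed matrix as a continuous linear functional. -/
noncomputable def frobCLM (σ : Matrix (Fin 3) (Fin 3) ℝ) : Matrix (Fin 3) (Fin 3) ℝ →L[ℝ] ℝ :=
  LinearMap.toContinuousLinearMap
    { toFun := frob σ, map_add' := frob_add_right σ,
      map_smul' := fun a τ => frob_smul_right a σ τ }

@[simp] theorem devCLM_apply (τ : Matrix (Fin 3) (Fin 3) ℝ) : devCLM τ = devM τ := rfl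

@[simp] theorem traceCLM_apply (τ : Matrix (Fin 3) (Fin 3) ℝ) : traceCLM τ = trace τ := rfl

/-- An entry of a matrix as a continuous linear functional. -/
noncomputable def entryCLM (i j : Fin 3) : Matrix (Fin 3) (Fin 3) ℝ →L[ℝ] ℝ :=
  LinearMap.toContinuousLinearMap (entryLinearMap ℝ ℝ i j)

theorem hasFDerivAt_frob_self (τ : Matrix (Fin 3) (Fin 3) ℝ) :
    HasFDerivAt (fun τ : Matrix (Fin 3) (Fin 3) ℝ => frob τ τ) ((2 : ℝ) • frobCLM τ) τ := by
  have h : HasFDerivAt (fun τ : Matrix (Fin 3) (Fin 3) ℝ =>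
      ∑ i, ∑ j, entryCLM i j τ * entryCLM i j τ) _ τ :=
    HasFDerivAt.fun_sum fun i _ => HasFDerivAt.fun_sum fun j _ =>
      (entryCLM i j).hasFDerivAt.mul (entryCLM i j).hasFDerivAt
  refine h.congr_fderiv ?_
  ext υ
  rw [_root_.sum_apply]
  simp_rw [_root_.sum_apply]
  change ∑ i, ∑ j, (τ i j * υ i j + τ i j * υ i j) = 2 * frob τ υ
  simp only [frob, Finset.mul_sum, two_mul]

theorem continuous_fnorm : Continuous fnorm := by
  have h : Continuous fun τ : Matrix (Fin 3) (Fin 3) ℝ => frob τ τ :=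
    continuous_iff_continuousAt.2 fun τ => (hasFDerivAt_frob_self τ).continuousAt
  exact h.sqrt

theorem hasFDerivAt_fnorm {τ : Matrix (Fin 3) (Fin 3) ℝ} (hτ : fnorm τ ≠ 0) :
    HasFDerivAt fnorm ((fnorm τ)⁻¹ • frobCLM τ) τ := by
  have h0 : frob τ τ ≠ 0 := fun h => hτ (by rw [fnorm, h, Real.sqrt_zero])
  refine ((hasFDerivAt_frob_self τ).sqrt h0).congr_fderiv ?_
  ext υ
  change 1 / (2 * fnorm τ) * (2 * frob τ υ) = (fnorm τ)⁻¹ * frob τ υ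
  field_simp

theorem hasFDerivAt_trace_sigTrDP (K G : ℝ) (εp ε : Matrix (Fin 3) (Fin 3) ℝ) :
    HasFDerivAt (fun ε => trace (sigTrDP K G εp ε)) ((3 * K) • traceCLM) ε := by
  have h : (fun ε => trace (sigTrDP K G εp ε)) = fun ε => (3 * K) • traceCLM (ε - εp) := by
    funext ε
    simp [sigTrDP, trace_Celast]
  rw [h]
  exact ((traceCLM.hasFDerivAt.comp ε ((hasFDerivAt_id ε).sub_const εp)).const_smul (3 * K))

theorem hasFDerivAt_devM_sigTrDP (K G : ℝ) (εp ε : Matrix (Fin 3) (Fin 3) ℝ) :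
    HasFDerivAt (fun ε => devM (sigTrDP K G εp ε)) ((2 * G) • devCLM) ε := by
  have h : (fun ε => devM (sigTrDP K G εp ε)) = fun ε => (2 * G) • devCLM (ε - εp) := by
    funext ε
    simp only [sigTrDP, devM_Celast, devCLM_apply]
  rw [h]
  exact ((devCLM.hasFDerivAt.comp ε ((hasFDerivAt_id ε).sub_const εp)).const_smul (2 * G))

theorem continuous_fnorm_devM_sigTrDP (K G : ℝ) (εp : Matrix (Fin 3) (Fin 3) ℝ) :
    Continuous fun ε => fnorm (devM (sigTrDP K G εp ε)) :=
  continuous_fnorm.comp <| continuous_iff_continuousAt.2 fun ε =>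
    (hasFDerivAt_devM_sigTrDP K G εp ε).continuousAt

theorem continuous_trace_sigTrDP (K G : ℝ) (εp : Matrix (Fin 3) (Fin 3) ℝ) :
    Continuous fun ε => trace (sigTrDP K G εp ε) :=
  continuous_iff_continuousAt.2 fun ε => (hasFDerivAt_trace_sigTrDP K G εp ε).continuousAt

/-- The set of strains that return to the smooth portion of the yield surface is open. -/
theorem isOpen_smoothReturn (K G η c : ℝ) (εp : Matrix (Fin 3) (Fin 3) ℝ) :
    IsOpen {ε : Matrix (Fin 3) (Fin 3) ℝ |
      0 < PsiDP η c (sigTrDP K G εp ε) ∧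
      η * (trace (sigTrDP K G εp ε) / 3) -
        K * η ^ 2 / (G * Real.sqrt 2) * fnorm (devM (sigTrDP K G εp ε)) < c} := by
  have hρ := continuous_fnorm_devM_sigTrDP K G εp
  have ht := continuous_trace_sigTrDP K G εp
  unfold PsiDP
  exact (isOpen_lt continuous_const
      (((hρ.const_mul _).add (ht.const_mul _)).sub continuous_const)).inter
    (isOpen_lt (((ht.div_const 3).const_mul η).sub (hρ.const_mul _)) continuous_const)

theorem fnorm_devM_pos_of_smoothReturn {K G η c : ℝ} {σ : Matrix (Fin 3) (Fin 3) ℝ}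
    (hΨ : 0 < PsiDP η c σ)
    (hs : η * (trace σ / 3) - K * η ^ 2 / (G * Real.sqrt 2) * fnorm (devM σ) < c) :
    0 < fnorm (devM σ) := by
  refine (Real.sqrt_nonneg _).lt_of_ne' fun h => ?_
  change fnorm (devM σ) = 0 at h
  rw [PsiDP, h] at hΨ
  rw [h] at hs
  linarith

theorem sqrt_half_mul_two : Real.sqrt (1 / 2) * 2 = Real.sqrt 2 := by
  rw [one_div, Real.sqrt_inv, inv_mul_eq_div, Real.div_sqrt]

/-- The gradient of the trial yield function is the flow direction `G√2 n^tr + Kη I`. -/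
theorem hasFDerivAt_PsiDP_sigTrDP (K G η c : ℝ) (εp ε : Matrix (Fin 3) (Fin 3) ℝ)
    (hρ : fnorm (devM (sigTrDP K G εp ε)) ≠ 0) :
    HasFDerivAt (fun ε => PsiDP η c (sigTrDP K G εp ε))
      (frobCLM ((G * Real.sqrt 2) • ntrDP K G εp ε + (K * η) • (1 : Matrix (Fin 3) (Fin 3) ℝ)))
      ε := by
  have h := ((((hasFDerivAt_fnorm hρ).comp ε (hasFDerivAt_devM_sigTrDP K G εp ε)).const_mul
    (Real.sqrt (1 / 2))).add
      ((hasFDerivAt_trace_sigTrDP K G εp ε).const_mul (η / 3))).sub_const c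
  refine h.congr_fderiv ?_
  ext υ
  change Real.sqrt (1 / 2) * ((fnorm (devM (sigTrDP K G εp ε)))⁻¹ *
      frob (devM (sigTrDP K G εp ε)) ((2 * G) • devM υ)) + η / 3 * (3 * K * trace υ) =
    frob ((G * Real.sqrt 2) • ntrDP K G εp ε + (K * η) • (1 : Matrix (Fin 3) (Fin 3) ℝ)) υ
  simp only [frob_smul_right, frob_devM_right (trace_devM _), ntrDP, frob_add_left,
    frob_smul_left, frob_one_left, ← sqrt_half_mul_two]
  ring

theorem hasFDerivAt_ntrDP (K G : ℝ) (εp ε : Matrix (Fin 3) (Fin 3) ℝ)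
    (hρ : fnorm (devM (sigTrDP K G εp ε)) ≠ 0) :
    HasFDerivAt (ntrDP K G εp)
      ((2 * G / fnorm (devM (sigTrDP K G εp ε))) •
        (devCLM - (frobCLM (ntrDP K G εp ε)).smulRight (ntrDP K G εp ε))) ε := by
  have hs := hasFDerivAt_devM_sigTrDP K G εp ε
  have h := ((hasDerivAt_inv hρ).comp_hasFDerivAt ε ((hasFDerivAt_fnorm hρ).comp ε hs)).smul hs
  refine h.congr_fderiv (ContinuousLinearMap.ext fun υ => ?_)
  change (fnorm (devM (sigTrDP K G εp ε)))⁻¹ • (2 * G) • devM υ +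
      (-(fnorm (devM (sigTrDP K G εp ε)) ^ 2)⁻¹ * ((fnorm (devM (sigTrDP K G εp ε)))⁻¹ *
        frob (devM (sigTrDP K G εp ε)) ((2 * G) • devM υ))) • devM (sigTrDP K G εp ε) =
    (2 * G / fnorm (devM (sigTrDP K G εp ε))) •
      (devM υ - frob (ntrDP K G εp ε) υ • ntrDP K G εp ε)
  simp only [frob_smul_right, frob_devM_right (trace_devM _), ntrDP, frob_smul_left]
  module

/-- `Celast` as a continuous linear map. -/
noncomputable def elastCLM (K G : ℝ) : Matrix (Fin 3) (Fin 3) ℝ →L[ℝ] Matrix (Fin 3) (Fin 3) ℝ :=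
  K • traceCLM.smulRight (1 : Matrix (Fin 3) (Fin 3) ℝ) + (2 * G) • devCLM

theorem elastCLM_apply (K G : ℝ) (ε : Matrix (Fin 3) (Fin 3) ℝ) :
    elastCLM K G ε = Celast K G ε := by
  simp [elastCLM, Celast, smul_smul]

theorem hasFDerivAt_sigTrDP (K G : ℝ) (εp ε : Matrix (Fin 3) (Fin 3) ℝ) :
    HasFDerivAt (sigTrDP K G εp) (elastCLM K G) ε := by
  have h : sigTrDP K G εp = fun ε => elastCLM K G (ε - εp) := by
    funext ε
    rw [elastCLM_apply, sigTrDP]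
  rw [h]
  exact (elastCLM K G).hasFDerivAt.comp ε ((hasFDerivAt_id ε).sub_const εp)

theorem TDP_eq_of_smoothReturn {K G η c : ℝ} {εp ε : Matrix (Fin 3) (Fin 3) ℝ}
    (hΨ : 0 < PsiDP η c (sigTrDP K G εp ε))
    (hs : η * (trace (sigTrDP K G εp ε) / 3) -
      K * η ^ 2 / (G * Real.sqrt 2) * fnorm (devM (sigTrDP K G εp ε)) < c) :
    TDP K G η c εp ε = sigTrDP K G εp ε - ((G + K * η ^ 2)⁻¹ * PsiDP η c (sigTrDP K G εp ε)) •
      ((G * Real.sqrt 2) • ntrDP K G εp ε + (K * η) • (1 : Matrix (Fin 3) (Fin 3) ℝ)) := by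
  simp only [sigTrDP] at hΨ hs
  simp only [TDP, ntrDP, sigTrDP, if_neg hΨ.not_ge, if_pos hs]
  module

/-- Consistent tangent operator for the Drucker–Prager smooth return: the smooth-return
region is open, and on it `T_k` is Fréchet differentiable with derivative
`DT_k(ε)[h] = ℂh − (1/(G+Kη²))[(2G²√2 Ψ(σ^tr)/ρ^tr)(dev h − (n^tr : h) n^tr)
  + ((G√2 n^tr + Kη I) : h)(G√2 n^tr + Kη I)]`. -/
theorem druckerPrager_consistent_tangent (K G η c : ℝ)
    (hK : 0 < K) (hG : 0 < G) (hη : 0 < η) (hc : 0 < c)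
    (εp : Matrix (Fin 3) (Fin 3) ℝ) (hεp : εp.IsSymm) :
    IsOpen {ε : Matrix (Fin 3) (Fin 3) ℝ |
      0 < PsiDP η c (sigTrDP K G εp ε) ∧
      η * (Matrix.trace (sigTrDP K G εp ε) / 3) -
        K * η ^ 2 / (G * Real.sqrt 2) * fnorm (devM (sigTrDP K G εp ε)) < c} ∧
    ∀ ε : Matrix (Fin 3) (Fin 3) ℝ,
      0 < PsiDP η c (sigTrDP K G εp ε) →
      η * (Matrix.trace (sigTrDP K G εp ε) / 3) -
        K * η ^ 2 / (G * Real.sqrt 2) * fnorm (devM (sigTrDP K G εp ε)) < c →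
      ∃ D : Matrix (Fin 3) (Fin 3) ℝ →L[ℝ] Matrix (Fin 3) (Fin 3) ℝ,
        HasFDerivAt (TDP K G η c εp) D ε ∧
        ∀ h : Matrix (Fin 3) (Fin 3) ℝ,
          D h = Celast K G h - (G + K * η ^ 2)⁻¹ •
            ((2 * G ^ 2 * Real.sqrt 2 * PsiDP η c (sigTrDP K G εp ε) /
                fnorm (devM (sigTrDP K G εp ε))) •
              (devM h - frob (ntrDP K G εp ε) h • ntrDP K G εp ε) +
            frob ((G * Real.sqrt 2) • ntrDP K G εp ε +
                (K * η) • (1 : Matrix (Fin 3) (Fin 3) ℝ)) h •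
              ((G * Real.sqrt 2) • ntrDP K G εp ε +
                (K * η) • (1 : Matrix (Fin 3) (Fin 3) ℝ))) := by
  refine ⟨isOpen_smoothReturn K G η c εp, fun ε hΨ hs => ?_⟩
  have hρ := (fnorm_devM_pos_of_smoothReturn hΨ hs).ne'
  have hT := (hasFDerivAt_sigTrDP K G εp ε).sub
    (((hasFDerivAt_PsiDP_sigTrDP K G η c εp ε hρ).const_mul (G + K * η ^ 2)⁻¹).smul
      (((hasFDerivAt_ntrDP K G εp ε hρ).const_smul (G * Real.sqrt 2)).add_const
        ((K * η) • (1 : Matrix (Fin 3) (Fin 3) ℝ))))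
  refine ⟨_, hT.congr_of_eventuallyEq ?_, fun h => ?_⟩
  · filter_upwards [(isOpen_smoothReturn K G η c εp).mem_nhds ⟨hΨ, hs⟩] with ε' hε'
    exact TDP_eq_of_smoothReturn hε'.1 hε'.2
  · change elastCLM K G h - (((G + K * η ^ 2)⁻¹ * PsiDP η c (sigTrDP K G εp ε)) •
          (G * Real.sqrt 2) • (2 * G / fnorm (devM (sigTrDP K G εp ε))) •
            (devM h - frob (ntrDP K G εp ε) h • ntrDP K G εp ε) +
        ((G + K * η ^ 2)⁻¹ *
          frob ((G * Real.sqrt 2) • ntrDP K G εp ε + (K * η) • (1 : Matrix (Fin 3) (Fin 3) ℝ)) h) •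
          ((G * Real.sqrt 2) • ntrDP K G εp ε + (K * η) • (1 : Matrix (Fin 3) (Fin 3) ℝ))) = _
    rw [elastCLM_apply]
    module
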